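/- arXiv:1905.10828 — 3 statements merged into one kernel-verified Lean document; each statement's English description precedes it below -/
import Mathlib

section
/- Consider a multibody system with coordinates q(t) ∈ ℝᵖ and velocities v(t) ∈ ℝᵐ satisfying the ODE system q̇ = N(q)v and M(q)v̇ = G(q)ᵀλ + f(t,q,v), where φ : ℝᵖ → ℝⁿ is a twice continuously differentiable constraint function, N(q) ∈ ℝ^{p×m}, M(q) ∈ ℝ^{m×m} is symmetric positive definite, G(q) = (∂φ/∂q)·N(q) ∈ ℝ^{n×m} has full row rank along the solution, K, B ∈ ℝ^{n×n} are nonnegative diagonal matrices, M̂(q) = (G M⁻¹ Gᵀ)⁻¹, and the constraint force is λ = −K φ(q) − B φ̇(q,v) − M̂ Ġ v with φ̇(q,v) = G(q)v. Assume N, M, G, f are twice continuously differentiable and a solution (q(t), v(t)) exists on [t₀, t₀+h̄] for some h̄ > 0. With subscript 0 denoting evaluation at (t₀, q(t₀), v(t₀)), define for h ∈ (0, h̄] the scheme outputs Y(h) = (I + M̂₀⁻¹(h²K + hB))⁻¹, φ̇₁(h) = Y(h)·(φ̇₀ − h M̂₀⁻¹ K φ₀ + h G₀ M₀⁻¹ f₀),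 and φ₁(h) = φ₀ + h φ̇₁(h). Then φ₁(h) − φ(q(t₀+h)) = O(h²) and φ̇₁(h) − G(q(t₀+h))·v(t₀+h) = O(h²) as h → 0⁺; that is, integrating φ and φ̇ independently from the multibody state by this scheme yields solutions with quadratic truncation error in h. -/
open Matrix Asymptotics

theorem isBigO_taylor_one_sq {E : Type*} [NormedAddCommGroup E] [NormedSpace ℝ E]
    {F F' : ℝ → E} {a δ : ℝ} (hδ : 0 < δ)
    (hF : ∀ t ∈ Set.Icc a (a + δ), HasDerivAt F (F' t) t) (hF' : DifferentiableAt ℝ F' a) :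
    (fun h : ℝ => F (a + h) - F a - h • F' a) =O[nhdsWithin 0 (Set.Ioi 0)] fun h : ℝ => h ^ 2 := by
  obtain ⟨C, hC, hb⟩ := hF'.isBigO_sub.exists_pos
  obtain ⟨ε, hε, hball⟩ := Metric.eventually_nhds_iff.1 hb.bound
  refine IsBigO.of_bound C ?_
  filter_upwards [Ioo_mem_nhdsGT (lt_min hε hδ)] with h hh
  obtain ⟨h0, hlt⟩ := hh
  have hhε := hlt.trans_le (min_le_left _ _)
  have hhδ := hlt.trans_le (min_le_right _ _)
  have hder : ∀ t ∈ Set.Icc a (a + h), HasDerivWithinAt (fun t => F t - (t - a) • F' a)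
      (F' t - F' a) (Set.Icc a (a + h)) t := by
    intro t ht
    have h1 := hF t ⟨ht.1, ht.2.trans (by linarith)⟩
    have h2 := ((hasDerivAt_id t).sub_const a).smul_const (F' a)
    simpa [Pi.sub_def] using (h1.sub h2).hasDerivWithinAt
  have hbound : ∀ t ∈ Set.Icc a (a + h), ‖F' t - F' a‖ ≤ C * h := by
    intro t ht
    have habs : |t - a| ≤ h := abs_le.2 ⟨by linarith [ht.1], by linarith [ht.2]⟩
    refine (hball (y := t) (by rw [Real.dist_eq]; linarith)).trans ?_
    rw [Real.norm_eq_abs]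
    gcongr
  have := (convex_Icc a (a + h)).norm_image_sub_le_of_norm_hasDerivWithin_le hder hbound
    (x := a) (y := a + h) ⟨le_rfl, by linarith⟩ ⟨by linarith, le_rfl⟩
  simp only [add_sub_cancel_left, sub_self, zero_smul, sub_zero, Real.norm_eq_abs,
    abs_of_pos h0] at this
  rw [Real.norm_eq_abs, abs_of_nonneg (sq_nonneg h), sub_right_comm]
  linarith

theorem differentiableAt_mulVec {k l : ℕ} {A : ℝ → Matrix (Fin k) (Fin l) ℝ}
    {x : ℝ → Fin l → ℝ} {t : ℝ} (hA : ∀ i j, DifferentiableAt ℝ (fun s => A s i j) t)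
    (hx : DifferentiableAt ℝ x t) : DifferentiableAt ℝ (fun s => A s *ᵥ x s) t := by
  rw [differentiableAt_pi]
  intro i
  simp only [mulVec, dotProduct]
  exact DifferentiableAt.fun_sum fun j _ => (hA i j).mul (differentiableAt_pi.1 hx j)

theorem hasDerivAt_mulVec {k l : ℕ} {A : ℝ → Matrix (Fin k) (Fin l) ℝ}
    {A' : Matrix (Fin k) (Fin l) ℝ} {x : ℝ → Fin l → ℝ} {x' : Fin l → ℝ} {t : ℝ}
    (hA : ∀ i j, HasDerivAt (fun s => A s i j) (A' i j) t) (hx : HasDerivAt x x' t) :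
    HasDerivAt (fun s => A s *ᵥ x s) (A' *ᵥ x t + A t *ᵥ x') t := by
  rw [hasDerivAt_pi]
  intro i
  simp only [mulVec, dotProduct, Pi.add_apply, ← Finset.sum_add_distrib]
  exact HasDerivAt.fun_sum fun j _ => (hA i j).mul (hasDerivAt_pi.1 hx j)

theorem differentiableAt_matrix_det {k : ℕ} {A : ℝ → Matrix (Fin k) (Fin k) ℝ} {t : ℝ}
    (hA : ∀ i j, DifferentiableAt ℝ (fun s => A s i j) t) :
    DifferentiableAt ℝ (fun s => (A s).det) t := by
  simp only [det_apply]
  exact DifferentiableAt.fun_sum fun σ _ =>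
    (DifferentiableAt.fun_finsetProd fun i _ => hA (σ i) i).const_smul _

theorem differentiableAt_matrix_inv {k : ℕ} {A : ℝ → Matrix (Fin k) (Fin k) ℝ} {t : ℝ}
    (hA : ∀ i j, DifferentiableAt ℝ (fun s => A s i j) t) (hdet : (A t).det ≠ 0) (i j : Fin k) :
    DifferentiableAt ℝ (fun s => (A s)⁻¹ i j) t := by
  simp only [inv_def, Matrix.smul_apply, adjugate_apply, Ring.inverse_eq_inv', smul_eq_mul]
  refine ((differentiableAt_matrix_det hA).inv hdet).mul (differentiableAt_matrix_det ?_)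
  intro i' j'
  simp only [updateRow_apply]
  split_ifs
  · exact differentiableAt_const _
  · exact hA i' j'

theorem posDef_mul_inv_mul_transpose {k l : ℕ} {A : Matrix (Fin k) (Fin l) ℝ}
    {M : Matrix (Fin l) (Fin l) ℝ} (hM : M.PosDef) (hA : A.rank = k) :
    (A * M⁻¹ * Aᵀ).PosDef := by
  rw [← conjTranspose_eq_transpose_of_trivial]
  refine hM.inv.mul_mul_conjTranspose_same (vecMul_injective_iff.2 ?_)
  rw [linearIndependent_iff_card_eq_finrank_span, Fintype.card_fin,
    Set.finrank, ← rank_eq_finrank_span_row, hA]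

theorem continuousAt_matrix_inv_of_eq_one {k : ℕ} {P : ℝ → Matrix (Fin k) (Fin k) ℝ} (hP : Continuous P)
    (h0 : P 0 = 1) : ContinuousAt (fun h => (P h)⁻¹) 0 := by
  simp only [inv_def, Ring.inverse_eq_inv']
  exact (hP.matrix_det.continuousAt.inv₀ (by simp [h0])).smul hP.matrix_adjugate.continuousAt

/-- The semi-implicit step agrees with the explicit Euler step up to second order. -/
theorem isBigO_semiImplicit_sub_euler {k : ℕ} (A K B : Matrix (Fin k) (Fin k) ℝ)
    (u b : Fin k → ℝ) :
    (fun h : ℝ => (1 + A * (h ^ 2 • K + h • B))⁻¹ *ᵥ (u + h • b)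
        - u - h • (b - A *ᵥ (B *ᵥ u)))
      =O[nhdsWithin 0 (Set.Ioi 0)] fun h : ℝ => h ^ 2 := by
  set P : ℝ → Matrix (Fin k) (Fin k) ℝ := fun h => 1 + A * (h ^ 2 • K + h • B) with hPdef
  set w := b - A *ᵥ (B *ᵥ u) with hw
  have hP : Continuous P := by fun_prop
  have hP0 : P 0 = 1 := by simp [hPdef]
  let c : ℝ → Fin k → ℝ := fun h =>
    (P h)⁻¹ *ᵥ (-(A *ᵥ (K *ᵥ u)) - A *ᵥ ((h • K + B) *ᵥ w))
  have hc : ContinuousAt c 0 := by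
    have h1 := continuousAt_matrix_inv_of_eq_one hP hP0
    have h2 : Continuous fun h : ℝ => -(A *ᵥ (K *ᵥ u)) - A *ᵥ ((h • K + B) *ᵥ w) := by fun_prop
    exact (continuous_fst.matrix_mulVec continuous_snd).continuousAt.comp
      (h1.prodMk h2.continuousAt)
  have hdet : ∀ᶠ h in nhdsWithin (0 : ℝ) (Set.Ioi 0), (P h).det ≠ 0 :=
    (hP.matrix_det.continuousAt.eventually_ne (by simp [hP0])).filter_mono nhdsWithin_le_nhds
  have hO : (fun h : ℝ => h ^ 2 • c h) =O[nhdsWithin 0 (Set.Ioi 0)] fun h : ℝ => h ^ 2 := by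
    simpa using (isBigO_refl (fun h : ℝ => h ^ 2) _).smul
      ((hc.tendsto.isBigO_one ℝ).mono nhdsWithin_le_nhds)
  refine hO.congr' ?_ Filter.EventuallyEq.rfl
  filter_upwards [hdet] with h hh
  have hinv : (P h)⁻¹ *ᵥ (P h *ᵥ (u + h • w)) = u + h • w := by
    rw [mulVec_mulVec, nonsing_inv_mul _ (Ne.isUnit hh), one_mulVec]
  have hres : h ^ 2 • (-(A *ᵥ (K *ᵥ u)) - A *ᵥ ((h • K + B) *ᵥ w))
      = u + h • b - P h *ᵥ (u + h • w) := by
    have hb : b = w + A *ᵥ (B *ᵥ u) := by rw [hw]; abel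
    rw [hb]
    simp only [hPdef, add_mulVec, one_mulVec, mulVec_add, mulVec_smul, smul_mulVec,
      ← mulVec_mulVec]
    module
  calc h ^ 2 • c h = (P h)⁻¹ *ᵥ (h ^ 2 • (-(A *ᵥ (K *ᵥ u)) - A *ᵥ ((h • K + B) *ᵥ w))) := by
        rw [mulVec_smul]
    _ = _ := by rw [hres, mulVec_sub, hinv]; abel

theorem hasDerivAt_comp_of_jacobian {p m n : ℕ} {φ : (Fin p → ℝ) → Fin n → ℝ}
    (hφ : Differentiable ℝ φ) {N : Matrix (Fin p) (Fin m) ℝ} {G : Matrix (Fin n) (Fin m) ℝ}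
    {q : ℝ → Fin p → ℝ} {x : Fin m → ℝ} {t : ℝ} (hq : HasDerivAt q (N *ᵥ x) t)
    (hG : ∀ i j, G i j =
      ∑ l, fderiv ℝ (fun q'' => φ q'' i) (q t) (Pi.single l 1) * N l j) :
    HasDerivAt (fun s => φ (q s)) (G *ᵥ x) t := by
  rw [hasDerivAt_pi]
  intro i
  have h1 := ((differentiable_pi.1 hφ i) (q t)).hasFDerivAt.comp_hasDerivAt t hq
  refine h1.congr_deriv ?_
  have h2 := LinearMap.pi_apply_eq_sum_univ
    (fderiv ℝ (fun q'' => φ q'' i) (q t)).toLinearMap (N *ᵥ x)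
  simp only [ContinuousLinearMap.coe_coe] at h2
  rw [h2, eq_comm]
  simp only [mulVec, dotProduct, hG, Finset.sum_mul, smul_eq_mul]
  rw [Finset.sum_comm]
  refine Finset.sum_congr rfl fun l _ => Finset.sum_congr rfl fun j _ => ?_
  have : (fun j => if l = j then (1 : ℝ) else 0) = Pi.single l 1 := by
    ext j; simp [Pi.single_apply, eq_comm]
  simp only [this]
  ring

/-- Theorem 1 of the paper: for the multibody system `q̇ = N(q)v`,
`M(q)v̇ = G(q)ᵀλ + f(t,q,v)` with constraint force
`λ = −Kφ(q) − Bφ̇(q,v) − M̂Ġv`, the first-order scheme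
`Y(h) = (I + M̂₀⁻¹(h²K + hB))⁻¹`,
`φ̇₁(h) = Y(h)(φ̇₀ − h M̂₀⁻¹Kφ₀ + h G₀M₀⁻¹f₀)`, `φ₁(h) = φ₀ + h φ̇₁(h)`
integrates `φ` and `φ̇` independently of the multibody state with quadratic
truncation error: `φ₁(h) − φ(q(t₀+h)) = O(h²)` and
`φ̇₁(h) − G(q(t₀+h))v(t₀+h) = O(h²)` as `h → 0⁺`. -/
theorem stmt2 {p m n : ℕ}
    (q : ℝ → Fin p → ℝ) (v : ℝ → Fin m → ℝ)
    (φ : (Fin p → ℝ) → Fin n → ℝ)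
    (N : (Fin p → ℝ) → Matrix (Fin p) (Fin m) ℝ)
    (M : (Fin p → ℝ) → Matrix (Fin m) (Fin m) ℝ)
    (G : (Fin p → ℝ) → Matrix (Fin n) (Fin m) ℝ)
    (f : ℝ → (Fin p → ℝ) → (Fin m → ℝ) → Fin m → ℝ)
    (K B : Matrix (Fin n) (Fin n) ℝ)
    (t₀ hbar : ℝ) (hhbar : 0 < hbar)
    (lam : ℝ → Fin n → ℝ)
    (Gdot : ℝ → Matrix (Fin n) (Fin m) ℝ)
    -- smoothness of the data
    (hφ : ContDiff ℝ 2 φ)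
    (hN : ∀ i j, ContDiff ℝ 2 fun q' => N q' i j)
    (hM : ∀ i j, ContDiff ℝ 2 fun q' => M q' i j)
    (hG : ∀ i j, ContDiff ℝ 2 fun q' => G q' i j)
    (hf : ContDiff ℝ 2 fun x : ℝ × (Fin p → ℝ) × (Fin m → ℝ) => f x.1 x.2.1 x.2.2)
    -- M(q) is symmetric positive definite
    (hMpd : ∀ q', (M q').PosDef)
    -- G(q) = (∂φ/∂q) N(q)
    (hGdef : ∀ q' i j, G q' i j =
      ∑ l, fderiv ℝ (fun q'' => φ q'' i) q' (Pi.single l 1) * N q' l j)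
    -- G has full row rank along the solution
    (hrank : ∀ t ∈ Set.Icc t₀ (t₀ + hbar), (G (q t)).rank = n)
    -- K, B are nonnegative diagonal
    (hK : K.IsDiag) (hKnn : ∀ i, 0 ≤ K i i)
    (hB : B.IsDiag) (hBnn : ∀ i, 0 ≤ B i i)
    -- Ġ is the time derivative of G along the solution
    (hGdot : ∀ t ∈ Set.Icc t₀ (t₀ + hbar), ∀ i j,
      HasDerivAt (fun s => G (q s) i j) (Gdot t i j) t)
    -- the constraint force law λ = −Kφ − Bφ̇ − M̂Ġv, with φ̇ = Gv, M̂ = (GM⁻¹Gᵀ)⁻¹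
    (hlam : ∀ t ∈ Set.Icc t₀ (t₀ + hbar), lam t =
      -(K *ᵥ φ (q t)) - B *ᵥ (G (q t) *ᵥ v t)
        - (G (q t) * (M (q t))⁻¹ * (G (q t))ᵀ)⁻¹ *ᵥ (Gdot t *ᵥ v t))
    -- the solution of the ODE system exists on [t₀, t₀ + h̄]
    (hq : ∀ t ∈ Set.Icc t₀ (t₀ + hbar), HasDerivAt q (N (q t) *ᵥ v t) t)
    (hv : ∀ t ∈ Set.Icc t₀ (t₀ + hbar),
      HasDerivAt v ((M (q t))⁻¹ *ᵥ ((G (q t))ᵀ *ᵥ lam t + f t (q t) (v t))) t)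
    -- the scheme outputs
    (Mhat₀ : Matrix (Fin n) (Fin n) ℝ)
    (hMhat₀ : Mhat₀ = (G (q t₀) * (M (q t₀))⁻¹ * (G (q t₀))ᵀ)⁻¹)
    (Y : ℝ → Matrix (Fin n) (Fin n) ℝ)
    (hY : ∀ h : ℝ, Y h = (1 + Mhat₀⁻¹ * (h ^ 2 • K + h • B))⁻¹)
    (φdot₁ : ℝ → Fin n → ℝ)
    (hφdot₁ : ∀ h : ℝ, φdot₁ h = Y h *ᵥ
      (G (q t₀) *ᵥ v t₀ - h • (Mhat₀⁻¹ *ᵥ (K *ᵥ φ (q t₀)))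
        + h • (G (q t₀) *ᵥ ((M (q t₀))⁻¹ *ᵥ f t₀ (q t₀) (v t₀)))))
    (φ₁ : ℝ → Fin n → ℝ)
    (hφ₁ : ∀ h : ℝ, φ₁ h = φ (q t₀) + h • φdot₁ h) :
    ((fun h : ℝ => φ₁ h - φ (q (t₀ + h)))
        =O[nhdsWithin 0 (Set.Ioi 0)] fun h : ℝ => h ^ 2) ∧
    ((fun h : ℝ => φdot₁ h - G (q (t₀ + h)) *ᵥ v (t₀ + h))
        =O[nhdsWithin 0 (Set.Ioi 0)] fun h : ℝ => h ^ 2) := by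
  have hmem : t₀ ∈ Set.Icc t₀ (t₀ + hbar) := ⟨le_rfl, by linarith⟩
  have hpd : ∀ t ∈ Set.Icc t₀ (t₀ + hbar),
      IsUnit (G (q t) * (M (q t))⁻¹ * (G (q t))ᵀ).det := fun t ht =>
    (posDef_mul_inv_mul_transpose (hMpd _) (hrank t ht)).det_pos.ne'.isUnit
  let w : ℝ → Fin n → ℝ := fun t =>
    G (q t) *ᵥ ((M (q t))⁻¹ *ᵥ
      ((G (q t))ᵀ *ᵥ (-(K *ᵥ φ (q t)) - B *ᵥ (G (q t) *ᵥ v t)) + f t (q t) (v t)))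
  have hu : ∀ t ∈ Set.Icc t₀ (t₀ + hbar),
      HasDerivAt (fun s => G (q s) *ᵥ v s) (w t) t := by
    intro t ht
    convert hasDerivAt_mulVec (hGdot t ht) (hv t ht) using 1
    have hcancel : G (q t) *ᵥ ((M (q t))⁻¹ *ᵥ ((G (q t))ᵀ *ᵥ
        ((G (q t) * (M (q t))⁻¹ * (G (q t))ᵀ)⁻¹ *ᵥ (Gdot t *ᵥ v t)))) = Gdot t *ᵥ v t := by
      rw [mulVec_mulVec, mulVec_mulVec, mulVec_mulVec,
        mul_nonsing_inv _ (hpd t ht), one_mulVec]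
    simp only [w, hlam t ht, mulVec_add, mulVec_sub, hcancel]
    abel
  have hφq : ∀ t ∈ Set.Icc t₀ (t₀ + hbar),
      HasDerivAt (fun s => φ (q s)) (G (q t) *ᵥ v t) t := fun t ht =>
    hasDerivAt_comp_of_jacobian (hφ.differentiable (by norm_num)) (hq t ht) (hGdef (q t))
  have hqd := (hq t₀ hmem).differentiableAt
  have hvd := (hv t₀ hmem).differentiableAt
  have hud := (hu t₀ hmem).differentiableAt
  have hGd : ∀ i j, DifferentiableAt ℝ (fun s => G (q s) i j) t₀ := fun i j =>
    (hGdot t₀ hmem i j).differentiableAt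
  have hMd : ∀ i j, DifferentiableAt ℝ (fun s => M (q s) i j) t₀ := fun i j =>
    (((hM i j).differentiable (by norm_num)) (q t₀)).comp t₀ hqd
  have hfd : DifferentiableAt ℝ (fun s => f s (q s) (v s)) t₀ :=
    DifferentiableAt.comp (g := fun x : ℝ × (Fin p → ℝ) × (Fin m → ℝ) => f x.1 x.2.1 x.2.2)
      (f := fun s => (s, q s, v s)) t₀ ((hf.differentiable (by norm_num)) (t₀, q t₀, v t₀))
      (differentiableAt_id.prodMk (hqd.prodMk hvd))
  have hwd : DifferentiableAt ℝ w t₀ := by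
    refine differentiableAt_mulVec hGd (differentiableAt_mulVec
      (differentiableAt_matrix_inv hMd (hMpd _).det_pos.ne') (DifferentiableAt.add
      (differentiableAt_mulVec (fun i j => hGd j i) (DifferentiableAt.sub
        (DifferentiableAt.neg ?_) ?_)) hfd))
    · exact differentiableAt_mulVec (fun _ _ => differentiableAt_const _)
        (hφq t₀ hmem).differentiableAt
    · exact differentiableAt_mulVec (fun _ _ => differentiableAt_const _) hud
  have hTu := isBigO_taylor_one_sq hhbar hu hwd
  have hTφ := isBigO_taylor_one_sq hhbar hφq hud
  have hstep : (fun h : ℝ => φdot₁ h - G (q t₀) *ᵥ v t₀ - h • w t₀)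
      =O[nhdsWithin 0 (Set.Ioi 0)] fun h : ℝ => h ^ 2 := by
    refine (isBigO_semiImplicit_sub_euler Mhat₀⁻¹ K B (G (q t₀) *ᵥ v t₀)
      (-(Mhat₀⁻¹ *ᵥ (K *ᵥ φ (q t₀)))
        + G (q t₀) *ᵥ ((M (q t₀))⁻¹ *ᵥ f t₀ (q t₀) (v t₀)))).congr_left fun h => ?_
    have hA : ∀ x, Mhat₀⁻¹ *ᵥ x = G (q t₀) *ᵥ ((M (q t₀))⁻¹ *ᵥ ((G (q t₀))ᵀ *ᵥ x)) := by
      intro x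
      rw [hMhat₀, nonsing_inv_nonsing_inv _ (hpd t₀ hmem), mulVec_mulVec, mulVec_mulVec]
    have hw0 : w t₀ = -(Mhat₀⁻¹ *ᵥ (K *ᵥ φ (q t₀)))
        + G (q t₀) *ᵥ ((M (q t₀))⁻¹ *ᵥ f t₀ (q t₀) (v t₀))
        - Mhat₀⁻¹ *ᵥ (B *ᵥ (G (q t₀) *ᵥ v t₀)) := by
      simp only [w, hA, mulVec_add, mulVec_sub, mulVec_neg]
      abel
    rw [← hw0, hφdot₁, hY]
    congr 3
    module
  have hφdot : (fun h : ℝ => φdot₁ h - G (q (t₀ + h)) *ᵥ v (t₀ + h))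
      =O[nhdsWithin 0 (Set.Ioi 0)] fun h : ℝ => h ^ 2 :=
    (hstep.sub hTu).congr_left fun h => by abel
  refine ⟨?_, hφdot⟩
  have hid : (fun h : ℝ => h) =O[nhdsWithin 0 (Set.Ioi 0)] fun _ : ℝ => (1 : ℝ) :=
    (Filter.tendsto_id.isBigO_one ℝ).mono nhdsWithin_le_nhds
  have hscaled : (fun h : ℝ => h • (φdot₁ h - G (q t₀) *ᵥ v t₀ - h • w t₀))
      =O[nhdsWithin 0 (Set.Ioi 0)] fun h : ℝ => h ^ 2 := by
    simpa using hid.smul hstep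
  have hquad : (fun h : ℝ => h ^ 2 • w t₀) =O[nhdsWithin 0 (Set.Ioi 0)] fun h : ℝ => h ^ 2 := by
    simpa using (isBigO_refl (fun h : ℝ => h ^ 2) _).smul
      (isBigO_const_const (w t₀) (one_ne_zero (α := ℝ)) _)
  refine ((hscaled.add hquad).sub hTφ).congr_left fun h => ?_
  rw [hφ₁]
  module
end

section
/- Let M ∈ ℝ^{m×m} be symmetric positive definite, G ∈ ℝ^{n×m} have full row rank, K, B ∈ ℝ^{n×n} be nonnegative diagonal matrices, Ġ ∈ ℝ^{n×m} be arbitrary, h > 0, and let φ₀, φ̇₀ ∈ ℝⁿ, v₀ ∈ ℝᵐ, f ∈ ℝᵐ be given vectors. Set M̂ = (G M⁻¹ Gᵀ)⁻¹ and Y = (I + M̂⁻¹(h²K + hB))⁻¹ (which exists). Then the 3-block linear system in unknowns (φ₁, φ̇₁, λ₁) ∈ ℝⁿ × ℝⁿ × ℝⁿ given by: φ₁ = φ₀ + h φ̇₁; φ̇₁ = φ̇₀ + h(G M⁻¹(Gᵀ λ₁ + f) + Ġ v₀); λ₁ = −K φ₁ − B φ̇₁ − M̂ Ġ v₀, has a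 unique solution, and this solution satisfies φ̇₁ = Y·(φ̇₀ − h M̂⁻¹ K φ₀ + h G M⁻¹ f) and φ₁ = φ₀ + h φ̇₁. In particular, the Ġ v₀ terms cancel and the update is independent of Ġ. -/
open Matrix

/-- A matrix whose rank is its number of rows is injective under left multiplication. -/
theorem Matrix.vecMul_injective_of_rank_eq {m n : ℕ} {G : Matrix (Fin n) (Fin m) ℝ}
    (hrank : G.rank = n) : Function.Injective G.vecMul := by
  rw [Matrix.vecMul_injective_iff, linearIndependent_iff_card_eq_finrank_span,
    Set.finrank, ← Matrix.rank_eq_finrank_span_row, hrank, Fintype.card_fin]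

/-- If `A` is positive definite and `D` is positive semidefinite, then `1 + A * D` is
invertible. -/
theorem Matrix.PosDef.isUnit_one_add_mul {ι : Type*} [Fintype ι] [DecidableEq ι]
    {A D : Matrix ι ι ℝ} (hA : A.PosDef) (hD : D.PosSemidef) : IsUnit (1 + A * D) := by
  rw [← Matrix.mulVec_injective_iff_isUnit]
  refine (injective_iff_map_eq_zero (1 + A * D).mulVecLin).2 fun x hx => ?_
  have hsol : x + A *ᵥ (D *ᵥ x) = 0 := by
    simpa [Matrix.add_mulVec, Matrix.mulVec_mulVec] using hx
  have hDx : D *ᵥ x = 0 := by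
    by_contra hne
    have hpos : 0 < (D *ᵥ x) ⬝ᵥ (A *ᵥ (D *ᵥ x)) := by
      simpa using hA.dotProduct_mulVec_pos hne
    have hnn : 0 ≤ x ⬝ᵥ (D *ᵥ x) := by simpa using hD.dotProduct_mulVec_nonneg x
    have hsum : (D *ᵥ x) ⬝ᵥ (x + A *ᵥ (D *ᵥ x)) = 0 := by rw [hsol, dotProduct_zero]
    rw [dotProduct_add, dotProduct_comm _ x] at hsum
    linarith
  simpa [hDx] using hsol

/-- A diagonal real matrix with nonnegative diagonal entries is positive semidefinite. -/
theorem Matrix.IsDiag.posSemidef {ι : Type*} [Fintype ι] [DecidableEq ι]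
    {D : Matrix ι ι ℝ} (hD : D.IsDiag) (hnn : ∀ i, 0 ≤ D i i) : D.PosSemidef := by
  rw [← hD.diagonal_diag]
  exact Matrix.PosSemidef.diagonal hnn

/-- The 3-block linear system of the discretized bilateral constraint problem has a
unique solution `(φ₁, φ̇₁, lam₁)`, and this solution is given in closed form by
`φ̇₁ = Y (φ̇₀ − h M̂⁻¹ K φ₀ + h G M⁻¹ f)` and `φ₁ = φ₀ + h φ̇₁`; in particular the
update is independent of `Ġ`. -/
theorem stmt3 {m n : ℕ} (M : Matrix (Fin m) (Fin m) ℝ) (G : Matrix (Fin n) (Fin m) ℝ)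
    (K B : Matrix (Fin n) (Fin n) ℝ) (Gdot : Matrix (Fin n) (Fin m) ℝ)
    (h : ℝ) (hh : 0 < h)
    (φ₀ φdot₀ : Fin n → ℝ) (v₀ f : Fin m → ℝ)
    (hM : M.PosDef) (hrank : G.rank = n)
    (hK : K.IsDiag) (hKnn : ∀ i, 0 ≤ K i i)
    (hB : B.IsDiag) (hBnn : ∀ i, 0 ≤ B i i)
    (Mhat : Matrix (Fin n) (Fin n) ℝ) (hMhat : Mhat = (G * M⁻¹ * Gᵀ)⁻¹)
    (Y : Matrix (Fin n) (Fin n) ℝ) (hY : Y = (1 + Mhat⁻¹ * (h ^ 2 • K + h • B))⁻¹) :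
    (∃! z : (Fin n → ℝ) × (Fin n → ℝ) × (Fin n → ℝ),
      z.1 = φ₀ + h • z.2.1 ∧
      z.2.1 = φdot₀ + h • (G *ᵥ (M⁻¹ *ᵥ (Gᵀ *ᵥ z.2.2 + f)) + Gdot *ᵥ v₀) ∧
      z.2.2 = -(K *ᵥ z.1) - B *ᵥ z.2.1 - Mhat *ᵥ (Gdot *ᵥ v₀)) ∧
    ∀ φ₁ φdot₁ lam₁ : Fin n → ℝ,
      (φ₁ = φ₀ + h • φdot₁ ∧
       φdot₁ = φdot₀ + h • (G *ᵥ (M⁻¹ *ᵥ (Gᵀ *ᵥ lam₁ + f)) + Gdot *ᵥ v₀) ∧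
       lam₁ = -(K *ᵥ φ₁) - B *ᵥ φdot₁ - Mhat *ᵥ (Gdot *ᵥ v₀)) →
      φdot₁ = Y *ᵥ (φdot₀ - h • (Mhat⁻¹ *ᵥ (K *ᵥ φ₀)) + h • (G *ᵥ (M⁻¹ *ᵥ f))) ∧
      φ₁ = φ₀ + h • φdot₁ := by
  obtain ⟨A, hA⟩ : ∃ A, A = G * M⁻¹ * Gᵀ := ⟨_, rfl⟩
  have hApos : A.PosDef := by
    have := hM.inv.mul_mul_conjTranspose_same (Matrix.vecMul_injective_of_rank_eq hrank)
    rwa [Matrix.conjTranspose_eq_transpose_of_trivial, ← hA] at this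
  have hAdet : IsUnit A.det := (Matrix.isUnit_iff_isUnit_det A).1 hApos.isUnit
  rw [← hA] at hMhat
  have hMinv : Mhat⁻¹ = A := by rw [hMhat, Matrix.nonsing_inv_nonsing_inv A hAdet]
  have hAM : A * Mhat = 1 := by rw [hMhat, Matrix.mul_nonsing_inv A hAdet]
  rw [hMinv] at hY ⊢
  have hD : (h ^ 2 • K + h • B).PosSemidef :=
    ((hK.posSemidef hKnn).smul (sq_nonneg h)).add ((hB.posSemidef hBnn).smul hh.le)
  have hWdet : IsUnit (1 + A * (h ^ 2 • K + h • B)).det :=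
    (Matrix.isUnit_iff_isUnit_det _).1 (hApos.isUnit_one_add_mul hD)
  have hWY : (1 + A * (h ^ 2 • K + h • B)) * Y = 1 := by
    rw [hY, Matrix.mul_nonsing_inv _ hWdet]
  have hYW : Y * (1 + A * (h ^ 2 • K + h • B)) = 1 := by
    rw [hY, Matrix.nonsing_inv_mul _ hWdet]
  obtain ⟨r, hr⟩ : ∃ r, r = φdot₀ - h • (A *ᵥ (K *ᵥ φ₀)) + h • (G *ᵥ (M⁻¹ *ᵥ f)) := ⟨_, rfl⟩
  rw [← hr]
  have residual (p : Fin n → ℝ) :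
      p - (φdot₀ + h • (G *ᵥ (M⁻¹ *ᵥ (Gᵀ *ᵥ (-(K *ᵥ (φ₀ + h • p)) - B *ᵥ p
        - Mhat *ᵥ (Gdot *ᵥ v₀)) + f)) + Gdot *ᵥ v₀))
      = (1 + A * (h ^ 2 • K + h • B)) *ᵥ p - r := by
    have hG (y : Fin n → ℝ) : G *ᵥ (M⁻¹ *ᵥ (Gᵀ *ᵥ y)) = A *ᵥ y := by
      rw [hA, Matrix.mulVec_mulVec, Matrix.mulVec_mulVec, Matrix.mul_assoc]
    have hc : A *ᵥ (Mhat *ᵥ (Gdot *ᵥ v₀)) = Gdot *ᵥ v₀ := by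
      rw [Matrix.mulVec_mulVec, hAM, Matrix.one_mulVec]
    rw [Matrix.mulVec_add M⁻¹, Matrix.mulVec_add G, hG, hr]
    simp only [Matrix.mulVec_sub, Matrix.mulVec_neg, Matrix.mulVec_add, Matrix.mulVec_smul, hc,
      Matrix.add_mulVec, Matrix.one_mulVec, ← Matrix.mulVec_mulVec, Matrix.smul_mulVec]
    module
  have solves (p : Fin n → ℝ) :
      p = φdot₀ + h • (G *ᵥ (M⁻¹ *ᵥ (Gᵀ *ᵥ (-(K *ᵥ (φ₀ + h • p)) - B *ᵥ p
        - Mhat *ᵥ (Gdot *ᵥ v₀)) + f)) + Gdot *ᵥ v₀) ↔ p = Y *ᵥ r := by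
    rw [← sub_eq_zero, residual, sub_eq_zero]
    constructor
    · intro hp
      rw [← hp, Matrix.mulVec_mulVec, hYW, Matrix.one_mulVec]
    · rintro rfl
      rw [Matrix.mulVec_mulVec, hWY, Matrix.one_mulVec]
  constructor
  · refine ⟨(φ₀ + h • Y *ᵥ r, Y *ᵥ r, -(K *ᵥ (φ₀ + h • Y *ᵥ r)) - B *ᵥ (Y *ᵥ r)
      - Mhat *ᵥ (Gdot *ᵥ v₀)), ⟨rfl, (solves _).2 rfl, rfl⟩, ?_⟩
    rintro ⟨x, p, l⟩ ⟨hx, hp, hl⟩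
    dsimp only at hx hp hl
    subst hx hl
    obtain rfl := (solves p).1 hp
    rfl
  · rintro x p l ⟨hx, hp, hl⟩
    subst hx hl
    exact ⟨(solves p).1 hp, rfl⟩
end

section
/- Let M ∈ ℝ^{m×m} be symmetric positive definite, G ∈ ℝ^{n×m} have full row rank, K, B ∈ ℝ^{n×n} be arbitrary matrices, Ġ ∈ ℝ^{n×m} arbitrary, and let φ, φ̇ ∈ ℝⁿ, v ∈ ℝᵐ, f ∈ ℝᵐ be vectors. Define M̂ = (G M⁻¹ Gᵀ)⁻¹, f̂ = M̂ G M⁻¹ f, λ = −K φ − B φ̇ − M̂ Ġ v, v̇ = M⁻¹(Gᵀ λ + f), and φ̈ = G v̇ + Ġ v. Then M̂ φ̈ + B φ̇ + K φ = f̂; that is, under the constraint force law λ, the constraint coordinates obey the mass-spring-damper equation with constraint-space inertia M̂ and constraint-space force f̂. -/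
open Matrix

/-- The rows of a matrix of full row rank are linearly independent. -/
theorem linearIndependent_row_of_rank_eq_card {ι κ F : Type*} [Fintype ι] [Fintype κ] [Field F]
    {A : Matrix ι κ F} (h : A.rank = Fintype.card ι) : LinearIndependent F A.row := by
  rw [linearIndependent_iff_card_eq_finrank_span, Set.finrank, ← A.rank_eq_finrank_span_row, h]

/-- If `M` is positive definite and `G` has full row rank, then `G M⁻¹ Gᵀ` is positive definite. -/
theorem posDef_mul_inv_mul_transpose_s4 {ι κ : Type*} [Fintype ι] [Fintype κ] [DecidableEq κ]
    {M : Matrix κ κ ℝ} {G : Matrix ι κ ℝ} (hM : M.PosDef) (hG : G.rank = Fintype.card ι) :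
    (G * M⁻¹ * Gᵀ).PosDef := by
  rw [← conjTranspose_eq_transpose_of_trivial]
  exact hM.inv.mul_mul_conjTranspose_same
    (vecMul_injective_iff.2 (linearIndependent_row_of_rank_eq_card hG))

/-- Under the constraint force law `λ = −Kφ − Bφ̇ − M̂Ġv`, the constraint coordinates
obey the mass-spring-damper equation `M̂ φ̈ + B φ̇ + K φ = f̂` with constraint-space
inertia `M̂ = (G M⁻¹ Gᵀ)⁻¹` and constraint-space force `f̂ = M̂ G M⁻¹ f`. -/
theorem stmt4 {m n : ℕ} (M : Matrix (Fin m) (Fin m) ℝ) (G : Matrix (Fin n) (Fin m) ℝ)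
    (K B : Matrix (Fin n) (Fin n) ℝ) (Gdot : Matrix (Fin n) (Fin m) ℝ)
    (φ φdot : Fin n → ℝ) (v f : Fin m → ℝ)
    (hM : M.PosDef) (hrank : G.rank = n)
    (Mhat : Matrix (Fin n) (Fin n) ℝ) (hMhat : Mhat = (G * M⁻¹ * Gᵀ)⁻¹)
    (fhat : Fin n → ℝ) (hfhat : fhat = Mhat *ᵥ (G *ᵥ (M⁻¹ *ᵥ f)))
    (lam : Fin n → ℝ) (hlam : lam = -(K *ᵥ φ) - B *ᵥ φdot - Mhat *ᵥ (Gdot *ᵥ v))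
    (vdot : Fin m → ℝ) (hvdot : vdot = M⁻¹ *ᵥ (Gᵀ *ᵥ lam + f))
    (φddot : Fin n → ℝ) (hφddot : φddot = G *ᵥ vdot + Gdot *ᵥ v) :
    Mhat *ᵥ φddot + B *ᵥ φdot + K *ᵥ φ = fhat := by
  have hdet : IsUnit (G * M⁻¹ * Gᵀ).det :=
    (isUnit_iff_isUnit_det _).1 (posDef_mul_inv_mul_transpose_s4 hM (by simpa using hrank)).isUnit
  have hcancel : Mhat *ᵥ (G *ᵥ (M⁻¹ *ᵥ (Gᵀ *ᵥ lam))) = lam := by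
    rw [mulVec_mulVec lam M⁻¹, mulVec_mulVec lam G, mulVec_mulVec, ← Matrix.mul_assoc G, hMhat,
      nonsing_inv_mul _ hdet, one_mulVec]
  rw [hφddot, hvdot, hfhat]
  simp only [mulVec_add, hcancel]
  rw [hlam]
  abel
end
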